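/- arXiv:2002.08748 — 3 statements merged into one kernel-verified Lean document; each statement's English description precedes it below -/
import Mathlib

section
/- Let K be a field, s ∈ Z^ν a shift, N a K[x]-submodule of K[x]^{1×ν} of rank ρ, and P ∈ K[x]^{ρ×ν} a basis of N. Then P is s-reduced if and only if for all λ = (λ_1,...,λ_ρ) ∈ K[x]^{1×ρ}, rdeg_s(λP) = max_{1≤i≤ρ}(deg(λ_i) + rdeg_s(P_{i,*])), i.e., rdeg_s(λP) = rdeg_d(λ) where d = rdeg_s(P) (the predictable degree property). -/
open Polynomial

noncomputable section

/-- s-row degree of a row vector of polynomials, with `deg 0 = ⊥`. -/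
def rdeg {K : Type*} [Field K] {ν : ℕ} (s : Fin ν → ℤ) (p : Fin ν → Polynomial K) : WithBot ℤ :=
  Finset.univ.sup fun i => WithBot.map (fun d : ℕ => (d : ℤ) + s i) (p i).degree

/-- s-leading matrix: the (i,j) entry is the coefficient of `x^(rdeg_s(P_i) - s_j)` in P_{i,j}. -/
def leadingMatrix {K : Type*} [Field K] {ρ ν : ℕ} (s : Fin ν → ℤ)
    (P : Fin ρ → Fin ν → Polynomial K) : Matrix (Fin ρ) (Fin ν) K :=
  Matrix.of fun i j =>
    if WithBot.map (fun d : ℕ => (d : ℤ) + s j) ((P i j).degree) = rdeg s (P i) then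
      (P i j).leadingCoeff else 0

/-- P (given by its rows) is a basis of the K[x]-module N. -/
def IsBasisOf {K : Type*} [Field K] {ρ ν : ℕ} (P : Fin ρ → Fin ν → Polynomial K)
    (N : Submodule (Polynomial K) (Fin ν → Polynomial K)) : Prop :=
  LinearIndependent (Polynomial K) P ∧ Submodule.span (Polynomial K) (Set.range P) = N

/-- The coefficient of `x^n` for an integer exponent `n`, which is zero when `n < 0`. -/
def intCoeff {K : Type*} [Field K] (p : Polynomial K) (n : ℤ) : K :=
  if 0 ≤ n then p.coeff n.toNat else 0

lemma intCoeff_natCast {K : Type*} [Field K] (p : Polynomial K) (k : ℕ) :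
    intCoeff p k = p.coeff k := by
  simp [intCoeff]

lemma intCoeff_sum {K : Type*} [Field K] {ι : Type*} (t : Finset ι) (f : ι → Polynomial K)
    (n : ℤ) : intCoeff (∑ i ∈ t, f i) n = ∑ i ∈ t, intCoeff (f i) n := by
  unfold intCoeff
  split_ifs <;> simp [Polynomial.finsetSum_coeff]

lemma eq_zero_of_coeff_eq_zero_of_neg {K : Type*} [Field K] {p : Polynomial K} {m : ℤ}
    (hp : ∀ k : ℕ, m < k → p.coeff k = 0) (hm : m < 0) : p = 0 := by
  ext k
  simpa using hp k (by lia)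

lemma natDegree_le_of_coeff_eq_zero {K : Type*} [Field K] {p : Polynomial K} {m : ℕ}
    (hp : ∀ k : ℕ, (m : ℤ) < k → p.coeff k = 0) : p.natDegree ≤ m :=
  Polynomial.natDegree_le_iff_coeff_eq_zero.2 fun k hk => hp k (by exact_mod_cast hk)

lemma intCoeff_mul_add {K : Type*} [Field K] {a b : Polynomial K} {m n : ℤ}
    (ha : ∀ k : ℕ, m < k → a.coeff k = 0) (hb : ∀ k : ℕ, n < k → b.coeff k = 0) :
    intCoeff (a * b) (m + n) = intCoeff a m * intCoeff b n := by
  rcases lt_or_ge m 0 with hm | hm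
  · simp [eq_zero_of_coeff_eq_zero_of_neg ha hm, intCoeff]
  rcases lt_or_ge n 0 with hn | hn
  · simp [eq_zero_of_coeff_eq_zero_of_neg hb hn, intCoeff]
  lift m to ℕ using hm
  lift n to ℕ using hn
  rw [← Nat.cast_add]
  simp only [intCoeff_natCast]
  exact Polynomial.coeff_mul_add_eq_of_natDegree_le (natDegree_le_of_coeff_eq_zero ha)
    (natDegree_le_of_coeff_eq_zero hb)

lemma coeff_mul_eq_zero_of_add_lt {K : Type*} [Field K] {a b : Polynomial K} {m n : ℤ}
    (ha : ∀ k : ℕ, m < k → a.coeff k = 0) (hb : ∀ k : ℕ, n < k → b.coeff k = 0)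
    {k : ℕ} (hk : m + n < k) : (a * b).coeff k = 0 := by
  rw [Polynomial.coeff_mul]
  refine Finset.sum_eq_zero fun x hx => ?_
  rw [Finset.HasAntidiagonal.mem_antidiagonal] at hx
  rcases lt_or_ge m (x.1 : ℤ) with h | h
  · rw [ha _ h, zero_mul]
  · rw [hb _ (by lia), mul_zero]

lemma rdeg_le_iff {K : Type*} [Field K] {ν : ℕ} {s : Fin ν → ℤ} {p : Fin ν → Polynomial K}
    {D : ℤ} : rdeg s p ≤ D ↔ ∀ j, ∀ k : ℕ, D - s j < k → (p j).coeff k = 0 := by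
  simp only [rdeg, Finset.sup_le_iff, Finset.mem_univ, true_implies]
  refine forall_congr' fun j => ?_
  by_cases hp : p j = 0
  · simp [hp]
  rw [Polynomial.degree_eq_natDegree hp]
  change (((p j).natDegree + s j : ℤ) : WithBot ℤ) ≤ D ↔ _
  rw [WithBot.coe_le_coe]
  constructor
  · intro h k hk
    exact Polynomial.coeff_eq_zero_of_natDegree_lt (by lia)
  · intro h
    by_contra hlt
    exact hp (Polynomial.leadingCoeff_eq_zero.1 (h (p j).natDegree (by lia)))

lemma rdeg_eq_iff {K : Type*} [Field K] {ν : ℕ} {s : Fin ν → ℤ} {p : Fin ν → Polynomial K}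
    {D : ℤ} (hD : rdeg s p ≤ D) :
    rdeg s p = D ↔ (fun j => intCoeff (p j) (D - s j)) ≠ 0 := by
  have hlt : rdeg s p = D ↔ ¬ rdeg s p ≤ ((D - 1 : ℤ) : WithBot ℤ) := by
    generalize rdeg s p = r at hD
    induction r with
    | bot => simp
    | coe r =>
      rw [WithBot.coe_le_coe] at hD ⊢
      rw [WithBot.coe_inj]
      lia
  rw [hlt, rdeg_le_iff, not_iff_not, funext_iff]
  rw [rdeg_le_iff] at hD
  refine forall_congr' fun j => ⟨fun h => ?_, fun h k hk => ?_⟩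
  · rw [intCoeff]
    split_ifs with h0
    · exact h _ (by lia)
    · rfl
  · rcases lt_or_ge (D - s j) (k : ℤ) with hk' | hk'
    · exact hD j k hk'
    · have hDk : D - s j = k := by lia
      simpa [hDk, intCoeff_natCast] using h

lemma leadingMatrix_apply {K : Type*} [Field K] {ρ ν : ℕ} {s : Fin ν → ℤ}
    {P : Fin ρ → Fin ν → Polynomial K} {i : Fin ρ} {d : ℤ} (hd : rdeg s (P i) = d) (j : Fin ν) :
    leadingMatrix s P i j = intCoeff (P i j) (d - s j) := by
  have hle := rdeg_le_iff.1 hd.le j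
  simp only [leadingMatrix, Matrix.of_apply, hd]
  by_cases hp : P i j = 0
  · simp [hp, intCoeff]
  rw [Polynomial.degree_eq_natDegree hp]
  change (if (((P i j).natDegree + s j : ℤ) : WithBot ℤ) = d then _ else _) = _
  simp only [WithBot.coe_inj]
  split_ifs with h
  · rw [show d - s j = (P i j).natDegree by lia, intCoeff_natCast, Polynomial.leadingCoeff]
  · have hn : ¬ d - s j < (P i j).natDegree := fun hlt =>
      hp (Polynomial.leadingCoeff_eq_zero.1 (hle _ hlt))
    rw [intCoeff, if_pos (by lia), Polynomial.coeff_eq_zero_of_natDegree_lt (by lia)]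

lemma exists_rdeg_eq_coe {K : Type*} [Field K] {ν : ℕ} (s : Fin ν → ℤ)
    {p : Fin ν → Polynomial K} (hp : p ≠ 0) : ∃ d : ℤ, rdeg s p = d := by
  obtain ⟨j, hj⟩ := Function.ne_iff.1 hp
  rw [← WithBot.ne_bot_iff_exists.trans (exists_congr fun _ => eq_comm)]
  intro h
  have hb := (Finset.sup_eq_bot_iff _ _).1 h j (Finset.mem_univ j)
  rw [WithBot.map_eq_bot_iff, Polynomial.degree_eq_bot] at hb
  exact hj hb

lemma rdeg_zero {K : Type*} [Field K] {ν : ℕ} (s : Fin ν → ℤ) :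
    rdeg s (0 : Fin ν → Polynomial K) = ⊥ := by
  simp [rdeg]

lemma sup_degree_add_eq_rdeg {K : Type*} [Field K] {ρ : ℕ} (d : Fin ρ → ℤ)
    (lam : Fin ρ → Polynomial K) :
    (Finset.univ.sup fun i =>
      WithBot.map (fun d : ℕ => (d : ℤ)) (lam i).degree + (d i : WithBot ℤ)) = rdeg d lam := by
  refine Finset.sup_congr rfl fun i _ => ?_
  cases (lam i).degree <;> rfl

section Combination

variable {K : Type*} [Field K] {ρ ν : ℕ} {s : Fin ν → ℤ} {P : Fin ρ → Fin ν → Polynomial K}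
  {d : Fin ρ → ℤ} {lam : Fin ρ → Polynomial K} {D : ℤ}

lemma rdeg_combination_le (hd : ∀ i, rdeg s (P i) = d i) (hD : rdeg d lam ≤ D) :
    rdeg s (fun j => ∑ i, lam i * P i j) ≤ D := by
  rw [rdeg_le_iff] at hD ⊢
  intro j k hk
  rw [Polynomial.finsetSum_coeff]
  exact Finset.sum_eq_zero fun i _ => coeff_mul_eq_zero_of_add_lt (hD i)
    (rdeg_le_iff.1 (hd i).le j) (by lia)

lemma intCoeff_combination (hd : ∀ i, rdeg s (P i) = d i) (hD : rdeg d lam ≤ D) :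
    (fun j => intCoeff (∑ i, lam i * P i j) (D - s j)) =
      Matrix.vecMul (fun i => intCoeff (lam i) (D - d i)) (leadingMatrix s P) := by
  ext j
  rw [intCoeff_sum, Matrix.vecMul, dotProduct]
  refine Finset.sum_congr rfl fun i _ => ?_
  rw [leadingMatrix_apply (hd i), ← intCoeff_mul_add (rdeg_le_iff.1 hD i)
    (rdeg_le_iff.1 (hd i).le j)]
  congr 1
  ring

lemma rdeg_combination_eq_iff (hd : ∀ i, rdeg s (P i) = d i) (hD : rdeg d lam ≤ D) :
    rdeg s (fun j => ∑ i, lam i * P i j) = D ↔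
      Matrix.vecMul (fun i => intCoeff (lam i) (D - d i)) (leadingMatrix s P) ≠ 0 := by
  rw [rdeg_eq_iff (rdeg_combination_le hd hD), intCoeff_combination hd hD]

end Combination

lemma exists_intCoeff_eq {K : Type*} [Field K] {ρ : ℕ} (d : Fin ρ → ℤ) (c : Fin ρ → K) :
    ∃ (lam : Fin ρ → Polynomial K) (D : ℤ), rdeg d lam ≤ D ∧
      (fun i => intCoeff (lam i) (D - d i)) = c := by
  obtain ⟨D, hD⟩ := (Set.finite_range d).bddAbove
  have hD' : ∀ i, d i ≤ D := fun i => hD ⟨i, rfl⟩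
  refine ⟨fun i => Polynomial.monomial (D - d i).toNat (c i), D, ?_, ?_⟩
  · rw [rdeg_le_iff]
    intro i k hk
    have hi := hD' i
    rw [Polynomial.coeff_monomial, if_neg (by lia)]
  · ext i
    rw [intCoeff, if_pos (by linarith [hD' i]), Polynomial.coeff_monomial, if_pos rfl]

lemma rank_eq_iff_vecMul_eq_zero {K : Type*} [Field K] {ρ ν : ℕ} (L : Matrix (Fin ρ) (Fin ν) K) :
    L.rank = ρ ↔ ∀ c : Fin ρ → K, Matrix.vecMul c L = 0 → c = 0 := by
  have h : L.rank = ρ ↔ LinearIndependent K L.row := by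
    rw [linearIndependent_iff_card_eq_finrank_span, Fintype.card_fin,
      Matrix.rank_eq_finrank_span_row, Set.finrank, eq_comm]
  rw [h, ← Matrix.vecMul_injective_iff, ← Matrix.coe_vecMulLinear, injective_iff_map_eq_zero]
  rfl

/-- **Predictable degree property** (Proposition `prop:predictable`).
A basis `P` of `N` is `s`-reduced iff for all `λ ∈ K[x]^{1×ρ}`,
`rdeg_s(λP) = max_i (deg λ_i + rdeg_s(P_{i,*}))`. -/
theorem predictable_degree_property {K : Type*} [Field K] {ρ ν : ℕ} (s : Fin ν → ℤ)
    (N : Submodule (Polynomial K) (Fin ν → Polynomial K))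
    (P : Fin ρ → Fin ν → Polynomial K)
    (hbasis : IsBasisOf P N) :
    (leadingMatrix s P).rank = ρ ↔
      ∀ lam : Fin ρ → Polynomial K,
        rdeg s (fun j => ∑ i, lam i * P i j) =
          Finset.univ.sup
            (fun i => WithBot.map (fun d : ℕ => (d : ℤ)) (lam i).degree + rdeg s (P i)) := by
  obtain ⟨d, hd⟩ := Classical.skolem.1 fun i => exists_rdeg_eq_coe s (hbasis.1.ne_zero i)
  simp only [hd, sup_degree_add_eq_rdeg, rank_eq_iff_vecMul_eq_zero]
  constructor
  · intro h lam
    by_cases hlam : lam = 0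
    · subst hlam
      simp [rdeg]
    · obtain ⟨D, hD⟩ := exists_rdeg_eq_coe d hlam
      rw [hD, rdeg_combination_eq_iff hd hD.le]
      exact fun h0 => (rdeg_eq_iff hD.le).1 hD (h _ h0)
  · intro h c hc
    obtain ⟨lam, D, hD, rfl⟩ := exists_intCoeff_eq d c
    by_contra hne
    exact (rdeg_combination_eq_iff hd hD).1 ((h lam).trans ((rdeg_eq_iff hD).2 hne)) hc
end
end

section
/- Let K be a field, s ∈ Z^ν a shift, and N a K[x]-submodule of K[x]^{1×ν} of rank ν. If P and Q are two bases of N, both in s-ordered weak Popov form, then P and Q have the same s-row degrees and the same s-pivot degrees. -/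
open Polynomial

noncomputable section

/-- `p` has s-pivot index `i` and s-pivot degree `d`. -/
def IsPivot {K : Type*} [Field K] {ν : ℕ} (s : Fin ν → ℤ) (p : Fin ν → Polynomial K)
    (i : Fin ν) (d : ℕ) : Prop :=
  (p i).degree = (d : WithBot ℕ) ∧
  WithBot.map (fun k : ℕ => (k : ℤ) + s i) (p i).degree = rdeg s p ∧
  ∀ j : Fin ν, WithBot.map (fun k : ℕ => (k : ℤ) + s j) (p j).degree = rdeg s p → j ≤ i

theorem IsPivot.rdeg_eq {K : Type*} [Field K] {ν : ℕ} {s : Fin ν → ℤ} {p : Fin ν → K[X]}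
    {i : Fin ν} {d : ℕ} (h : IsPivot s p i d) : rdeg s p = ((d + s i : ℤ) : WithBot ℤ) := by
  rw [← h.2.1, h.1]
  rfl

theorem IsPivot.natDegree_eq {K : Type*} [Field K] {ν : ℕ} {s : Fin ν → ℤ} {p : Fin ν → K[X]}
    {i : Fin ν} {d : ℕ} (h : IsPivot s p i d) : (p i).natDegree = d :=
  natDegree_eq_of_degree_eq_some h.1

theorem IsPivot.ne_zero {K : Type*} [Field K] {ν : ℕ} {s : Fin ν → ℤ} {p : Fin ν → K[X]}
    {i : Fin ν} {d : ℕ} (h : IsPivot s p i d) : p i ≠ 0 := by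
  intro h0
  have := h.1
  simp [h0] at this

/-- The pivot maximizes the pair (shifted degree, index) lexicographically among the nonzero
entries. -/
theorem IsPivot.shifted_le {K : Type*} [Field K] {ν : ℕ} {s : Fin ν → ℤ} {p : Fin ν → K[X]}
    {i : Fin ν} {d : ℕ} (h : IsPivot s p i d) {j : Fin ν} (hj : p j ≠ 0) :
    (p j).natDegree + s j < d + s i ∨ (p j).natDegree + s j = d + s i ∧ j ≤ i := by
  have hmap : WithBot.map (fun k : ℕ => (k : ℤ) + s j) (p j).degree =
      (((p j).natDegree + s j : ℤ) : WithBot ℤ) := by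
    rw [degree_eq_natDegree hj]
    rfl
  have hle : WithBot.map (fun k : ℕ => (k : ℤ) + s j) (p j).degree ≤ rdeg s p :=
    Finset.le_sup (f := fun i => WithBot.map (fun d : ℕ => (d : ℤ) + s i) (p i).degree)
      (Finset.mem_univ j)
  have hidx := h.2.2 j
  rw [hmap, h.rdeg_eq] at hle hidx
  rcases (WithBot.coe_le_coe.1 hle).lt_or_eq with hlt | heq
  · exact Or.inl hlt
  · exact Or.inr ⟨heq, hidx (congrArg _ heq)⟩

/-- If the rows of `P` have their pivots on the diagonal, then a combination of these rows with
pivot index `i` has pivot degree at least that of the row `P i`. -/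
theorem IsPivot.le_of_sum_smul {K : Type*} [Field K] {ν : ℕ} {s : Fin ν → ℤ}
    {P : Fin ν → Fin ν → K[X]} {d : Fin ν → ℕ} (hP : ∀ k, IsPivot s (P k) k (d k))
    {c : Fin ν → K[X]} {i : Fin ν} {e : ℕ} (hq : IsPivot s (∑ k, c k • P k) i e) :
    d i ≤ e := by
  have hsum : ∀ j, (∑ k, c k • P k) j = ∑ k, c k * P k j := fun j => by
    simp [Finset.sum_apply]
  have hterm : ∀ j n, ((∑ k, c k • P k) j).coeff n = ∑ k, (c k * P k j).coeff n := fun j n => by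
    rw [hsum, finsetSum_coeff]
  have hei : ((∑ k, c k • P k) i).coeff e ≠ 0 := by
    rw [← hq.natDegree_eq]
    exact leadingCoeff_ne_zero.2 hq.ne_zero
  rw [hterm] at hei
  obtain ⟨k₁, -, hk₁⟩ := Finset.exists_ne_zero_of_sum_ne_zero hei
  have hbound : ∀ k j n, (c k * P k j).coeff n ≠ 0 → c k ≠ 0 ∧
      ((n : ℤ) + s j < (c k).natDegree + d k + s k ∨
        (n : ℤ) + s j = (c k).natDegree + d k + s k ∧ j ≤ k) := by
    intro k j n hn
    have hc : c k ≠ 0 := fun h => hn (by simp [h])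
    have hp : P k j ≠ 0 := fun h => hn (by simp [h])
    have hdeg := le_natDegree_of_ne_zero hn
    rw [natDegree_mul hc hp] at hdeg
    refine ⟨hc, ?_⟩
    rcases (hP k).shifted_le hp with h | ⟨h, hjk⟩
    · left; omega
    · by_cases hlt : (n : ℤ) + s j < (c k).natDegree + d k + s k
      · exact Or.inl hlt
      · exact Or.inr ⟨by omega, hjk⟩
  classical
  obtain ⟨m, hm, hmax⟩ := Finset.exists_max_image (Finset.univ.filter fun k => c k ≠ 0)
    (fun k => toLex (((c k).natDegree + d k + s k : ℤ), k)) ⟨k₁, by simp [(hbound _ _ _ hk₁).1]⟩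
  replace hm : c m ≠ 0 := by simpa using hm
  replace hmax : ∀ k, c k ≠ 0 →
      ((c k).natDegree + d k + s k : ℤ) < (c m).natDegree + d m + s m ∨
      ((c k).natDegree + d k + s k : ℤ) = (c m).natDegree + d m + s m ∧ k ≤ m := by
    intro k hk
    simpa [Prod.Lex.toLex_le_toLex] using hmax k (by simpa using hk)
  have hlead : ((∑ k, c k • P k) m).coeff ((c m).natDegree + d m) ≠ 0 := by
    rw [hterm, Finset.sum_eq_single m]
    · rw [← (hP m).natDegree_eq, coeff_mul_degree_add_degree]
      exact mul_ne_zero (leadingCoeff_ne_zero.2 hm) (leadingCoeff_ne_zero.2 (hP m).ne_zero)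
    · intro k _ hkm
      by_contra hne
      obtain ⟨hc, hb⟩ := hbound _ _ _ hne
      have := hmax k hc
      push_cast at hb
      omega
    · simp
  have hqm : (∑ k, c k • P k) m ≠ 0 := fun h => hlead (by simp [h])
  have hdeg := le_natDegree_of_ne_zero hlead
  have hpiv := hq.shifted_le hqm
  obtain ⟨hc, hb⟩ := hbound _ _ _ hk₁
  have hmk := hmax k₁ hc
  obtain rfl : i = m := by omega
  omega

theorem IsBasisOf.pivot_degree_le {K : Type*} [Field K] {ν : ℕ} {s : Fin ν → ℤ}
    {N : Submodule K[X] (Fin ν → K[X])} {P Q : Fin ν → Fin ν → K[X]}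
    (hP : IsBasisOf P N) (hQ : IsBasisOf Q N) {dP dQ : Fin ν → ℕ}
    (hPpiv : ∀ k, IsPivot s (P k) k (dP k)) (hQpiv : ∀ k, IsPivot s (Q k) k (dQ k)) :
    dP ≤ dQ := by
  intro i
  have hmem : Q i ∈ Submodule.span K[X] (Set.range P) := by
    rw [hP.2, ← hQ.2]
    exact Submodule.subset_span ⟨i, rfl⟩
  obtain ⟨c, hc⟩ := (Submodule.mem_span_range_iff_exists_fun _).1 hmem
  exact IsPivot.le_of_sum_smul hPpiv (hc.symm ▸ hQpiv i)

/-- **Uniqueness of row and pivot degrees of ordered weak Popov bases**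
(Lemma `lm:uniqrdeg`). If `P` and `Q` are two bases of a rank-`ν` submodule `N` of
`K[x]^{1×ν}`, both in s-ordered weak Popov form, then they have the same s-row degrees
and the same s-pivot degrees. -/
theorem ordered_weak_popov_unique_degrees {K : Type*} [Field K] {ν : ℕ} (s : Fin ν → ℤ)
    (N : Submodule (Polynomial K) (Fin ν → Polynomial K))
    (P Q : Fin ν → Fin ν → Polynomial K)
    (hP : IsBasisOf P N) (hQ : IsBasisOf Q N)
    (pivP pivQ : Fin ν → Fin ν) (dP dQ : Fin ν → ℕ)
    (hPpiv : ∀ k, IsPivot s (P k) (pivP k) (dP k)) (hPmono : StrictMono pivP)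
    (hQpiv : ∀ k, IsPivot s (Q k) (pivQ k) (dQ k)) (hQmono : StrictMono pivQ) :
    (∀ i, rdeg s (P i) = rdeg s (Q i)) ∧ dP = dQ := by
  obtain rfl : pivP = id := hPmono.eq_id
  obtain rfl : pivQ = id := hQmono.eq_id
  have hd : dP = dQ := le_antisymm (hP.pivot_degree_le hQ hPpiv hQpiv)
    (hQ.pivot_degree_le hP hQpiv hPpiv)
  exact ⟨fun i => by rw [(hPpiv i).rdeg_eq, (hQpiv i).rdeg_eq, hd], hd⟩
end
end

section
/- Let K be a field, m ≥ n ≥ 1, a_1,...,a_n ∈ K[x] nonzero with a_n | a_{n-1} | ... | a_1, M = ⟨a_i(x)·ε'_i⟩ ⊆ K[x]^n, M ∈ K[x]^{m×n}, s ∈ Z^m a shift, and φ_M(p) = pM mod M. Let δ = (δ_1,...,δ_m) be the s-pivot degrees of the relation module A_{M,M} = ker(φ_M) (the s-pivot degrees of any basis of A_{M,M} in s-ordered weak Popov form). Then for every 1 ≤ j ≤ m, δ_j = min{d ∈ N : φ_M(x^d ε_j) lies in the K-linear span of {φ_M(x^k ε_i) : x^k ε_i ≺_{s-TOP} x^d ε_j}}.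 -/
open Polynomial

noncomputable section

/-- the submodule M = ⟨a_i ε'_i⟩ of K[x]^n -/
def Mmod {K : Type*} [Field K] {n : ℕ} (a : Fin n → Polynomial K) :
    Submodule (Polynomial K) (Fin n → Polynomial K) :=
  Submodule.span (Polynomial K) (Set.range fun i => Pi.single i (a i))

/-- row-vector times matrix: (p M)_j = Σ_i p_i M_{i,j} -/
def pmul {K : Type*} [Field K] {m n : ℕ} (M : Matrix (Fin m) (Fin n) (Polynomial K))
    (p : Fin m → Polynomial K) : Fin n → Polynomial K :=
  fun j => ∑ i, p i * M i j

/-- the monomial x^k ε_j of K[x]^{1×m}, encoded by the pair (k, j) -/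
def monov {K : Type*} [Field K] {m : ℕ} (μ : ℕ × Fin m) : Fin m → Polynomial K :=
  Pi.single μ.2 (X ^ μ.1)

/-- the s-TOP order on monomials: x^a ε_i ≺ x^b ε_j iff (a+s_i, i) <_lex (b+s_j, j) -/
def sTopLT {m : ℕ} (s : Fin m → ℤ) (μ ν : ℕ × Fin m) : Prop :=
  ((μ.1 : ℤ) + s μ.2 < (ν.1 : ℤ) + s ν.2) ∨
  ((μ.1 : ℤ) + s μ.2 = (ν.1 : ℤ) + s ν.2 ∧ μ.2 < ν.2)

/-- the monomials `x^k ε_i` sorted by the s-TOP order -/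
def sTopKey {m : ℕ} (s : Fin m → ℤ) (μ : ℕ × Fin m) : ℤ ×ₗ Fin m :=
  toLex ((μ.1 : ℤ) + s μ.2, μ.2)

theorem sTopLT_iff_key {m : ℕ} (s : Fin m → ℤ) (μ ν : ℕ × Fin m) :
    sTopLT s μ ν ↔ sTopKey s μ < sTopKey s ν := by
  simp [sTopLT, sTopKey, Prod.Lex.toLex_lt_toLex]

theorem sTopKey_injective {m : ℕ} (s : Fin m → ℤ) : Function.Injective (sTopKey s) := by
  rintro ⟨k, i⟩ ⟨l, j⟩ h
  simp only [sTopKey, EmbeddingLike.apply_eq_iff_eq, Prod.mk.injEq] at h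
  obtain ⟨h, rfl⟩ := h
  simpa using h

theorem sTopKey_add_le {m : ℕ} (s : Fin m → ℤ) {k l a b : ℕ} {i j : Fin m}
    (h : sTopKey s (k, i) ≤ sTopKey s (l, j)) (hab : a ≤ b) :
    sTopKey s (a + k, i) ≤ sTopKey s (b + l, j) := by
  simp only [sTopKey, Prod.Lex.toLex_le_toLex] at h ⊢
  push_cast
  rcases h with h | ⟨h, h'⟩
  · left; omega
  · rcases hab.lt_or_eq with hab | rfl
    · left; omega
    · right; exact ⟨by omega, h'⟩

/-- A pivot is the s-TOP-leading monomial. -/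
theorem IsPivot.key_le {K : Type*} [Field K] {m : ℕ} {s : Fin m → ℤ}
    {p : Fin m → Polynomial K} {j : Fin m} {d : ℕ} (h : IsPivot s p j d)
    {i : Fin m} {k : ℕ} (hk : (p i).coeff k ≠ 0) : sTopKey s (k, i) ≤ sTopKey s (d, j) := by
  obtain ⟨hd, hr, hmax⟩ := h
  have hp : p i ≠ 0 := fun h0 => hk (by simp [h0])
  have hkn : k ≤ (p i).natDegree := le_natDegree_of_ne_zero hk
  have hle : WithBot.map (fun k : ℕ => (k : ℤ) + s i) (p i).degree ≤ rdeg s p :=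
    Finset.le_sup (f := fun i => WithBot.map (fun d : ℕ => (d : ℤ) + s i) (p i).degree)
      (Finset.mem_univ i)
  have hmax := hmax i
  rw [hd] at hr
  rw [← hr, degree_eq_natDegree hp] at hle hmax
  change ((((p i).natDegree : ℤ) + s i : ℤ) : WithBot ℤ) ≤ (((d : ℤ) + s j : ℤ) : WithBot ℤ) at hle
  change ((((p i).natDegree : ℤ) + s i : ℤ) : WithBot ℤ) = (((d : ℤ) + s j : ℤ) : WithBot ℤ) → _
    at hmax
  rw [WithBot.coe_le_coe] at hle
  rw [WithBot.coe_inj] at hmax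
  simp only [sTopKey, Prod.Lex.toLex_le_toLex]
  by_cases hlt : (k : ℤ) + s i < d + s j
  · exact Or.inl hlt
  · exact Or.inr ⟨by omega, hmax (by omega)⟩

/-- The s-TOP-leading monomial of a combination of vectors with distinct pivot indices is a
multiple of the leading monomial of one of them. -/
theorem pivot_degree_le_of_combination {K : Type*} [Field K] {m : ℕ} {s : Fin m → ℤ}
    {P : Fin m → Fin m → Polynomial K} {δ : Fin m → ℕ} (hpiv : ∀ k, IsPivot s (P k) k (δ k))
    (u : Fin m → Polynomial K) {j : Fin m} {d : ℕ}
    (hne : ((∑ k, u k • P k) j).coeff d ≠ 0)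
    (hle : ∀ (i : Fin m) (k : ℕ), ((∑ l, u l • P l) i).coeff k ≠ 0 →
      sTopKey s (k, i) ≤ sTopKey s (d, j)) : δ j ≤ d := by
  classical
  have hcoeff (i : Fin m) (k : ℕ) :
      ((∑ l, u l • P l) i).coeff k = ∑ l, (u l * P l i).coeff k := by
    simp [Finset.sum_apply]
  let e : Fin m → ℕ := fun l => (u l).natDegree + δ l
  have hbound (l i : Fin m) (k : ℕ) (h : (u l * P l i).coeff k ≠ 0) :
      sTopKey s (k, i) ≤ sTopKey s (e l, l) := by
    rw [coeff_mul] at h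
    obtain ⟨⟨b, c⟩, hbc, hmul⟩ := Finset.exists_ne_zero_of_sum_ne_zero h
    obtain rfl := Finset.HasAntidiagonal.mem_antidiagonal.mp hbc
    exact sTopKey_add_le s ((hpiv l).key_le (right_ne_zero_of_mul hmul))
      (le_natDegree_of_ne_zero (left_ne_zero_of_mul hmul))
  have hlead (l : Fin m) (h : u l ≠ 0) : (u l * P l l).coeff (e l) ≠ 0 := by
    have hdeg : (P l l).natDegree = δ l := natDegree_eq_of_degree_eq_some (hpiv l).1
    have hP : P l l ≠ 0 := fun h0 => by simpa [h0] using (hpiv l).1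
    simp only [e, ← hdeg, coeff_mul_degree_add_degree]
    exact mul_ne_zero (leadingCoeff_ne_zero.mpr h) (leadingCoeff_ne_zero.mpr hP)
  rw [hcoeff] at hne
  obtain ⟨l₀, -, hl₀⟩ := Finset.exists_ne_zero_of_sum_ne_zero hne
  have hu₀ : u l₀ ≠ 0 := fun h => hl₀ (by simp [h])
  obtain ⟨l, hl, hlmax⟩ := Finset.exists_max_image (Finset.univ.filter fun l => u l ≠ 0)
    (fun l => sTopKey s (e l, l)) ⟨l₀, by simpa using hu₀⟩
  simp only [Finset.mem_filter, Finset.mem_univ, true_and] at hl hlmax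
  have hsum : ((∑ k, u k • P k) l).coeff (e l) ≠ 0 := by
    rw [hcoeff, Finset.sum_eq_single l]
    · exact hlead l hl
    · intro l' _ hl'
      by_contra h
      have hu : u l' ≠ 0 := fun h0 => h (by simp [h0])
      have := sTopKey_injective s (le_antisymm (hbound l' l _ h) (hlmax l' hu))
      exact hl' (congrArg Prod.snd this).symm
    · simp
  have heq := sTopKey_injective s
    (le_antisymm (hle _ _ hsum) ((hbound l₀ j d hl₀).trans (hlmax l₀ hu₀)))
  obtain ⟨rfl, rfl⟩ := Prod.mk.inj heq
  exact Nat.le_add_left _ _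

theorem coeff_monov {K : Type*} [Field K] {m : ℕ} (μ : ℕ × Fin m) (i : Fin m) (k : ℕ) :
    ((monov μ : Fin m → Polynomial K) i).coeff k = if (k, i) = μ then 1 else 0 := by
  obtain ⟨l, j⟩ := μ
  by_cases h : i = j
  · subst h; simp [monov, coeff_X_pow]
  · simp [monov, h]

theorem sum_smul_monov {K : Type*} [Field K] {m : ℕ} (v : Fin m → Polynomial K) :
    v = ∑ i, ∑ k ∈ (v i).support, (v i).coeff k • monov (k, i) := by
  ext i k
  simp only [Finset.sum_apply, finsetSum_coeff, Pi.smul_apply, coeff_smul, coeff_monov,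
    Prod.mk.injEq, smul_eq_mul, mul_ite, mul_one, mul_zero]
  rw [Finset.sum_eq_single i]
  · simp
  · intro b _ hb
    simp [hb.symm]
  · simp

/-- The span of a set of monomials consists of the vectors supported on that set. -/
theorem mem_span_monov_iff {K : Type*} [Field K] {m : ℕ} {S : Set (ℕ × Fin m)}
    {v : Fin m → Polynomial K} :
    v ∈ Submodule.span K (monov '' S) ↔ ∀ i k, (v i).coeff k ≠ 0 → (k, i) ∈ S := by
  constructor
  · intro hv
    induction hv using Submodule.span_induction with
    | mem x hx =>
      obtain ⟨μ, hμ, rfl⟩ := hx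
      intro i k h
      rw [coeff_monov] at h
      split_ifs at h with h'
      · exact h' ▸ hμ
      · exact absurd rfl h
    | zero => simp
    | add x y _ _ hx hy =>
      intro i k h
      by_cases h' : (x i).coeff k = 0
      · exact hy i k (by simpa [h'] using h)
      · exact hx i k h'
    | smul c x _ hx =>
      intro i k h
      exact hx i k (right_ne_zero_of_mul (by simpa using h))
  · intro h
    rw [sum_smul_monov v]
    refine Submodule.sum_mem _ fun i _ => Submodule.sum_mem _ fun k hk => ?_
    exact Submodule.smul_mem _ _ (Submodule.subset_span ⟨_, h i k (mem_support_iff.mp hk), rfl⟩)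

/-- **Pivot degrees of the relation module as minimal dependency degrees**
(Theorem `thm:pivot`). If `δ = (δ_1,...,δ_m)` are the s-pivot degrees of the relation
module `A_{M,M}` (pivot degrees of a basis in s-ordered weak Popov form), then for every
`j`, `δ_j` is the least `d` such that `φ_M(x^d ε_j)` lies in the K-linear span of the
images of the s-TOP-smaller monomials. -/
theorem relation_module_pivot_degree_min {K : Type*} [Field K] {m n : ℕ}
    (hmn : n ≤ m) (hn : 0 < n)
    (a : Fin n → Polynomial K) (ha : ∀ i, a i ≠ 0)
    (hdvd : ∀ i j : Fin n, i ≤ j → a j ∣ a i)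
    (M : Matrix (Fin m) (Fin n) (Polynomial K)) (s : Fin m → ℤ)
    (P : Fin m → Fin m → Polynomial K) (δ : Fin m → ℕ)
    (hbasis : IsBasisOf P ((Mmod a).comap (Matrix.vecMulLinear (R := Polynomial K) M)))
    (hpiv : ∀ k, IsPivot s (P k) k (δ k)) :
    ∀ j : Fin m,
      IsLeast {d : ℕ |
        (Submodule.Quotient.mk (pmul M (monov (d, j))) : (Fin n → Polynomial K) ⧸ Mmod a) ∈
          Submodule.span K
            ((fun μ : ℕ × Fin m =>
                (Submodule.Quotient.mk (pmul M (monov μ)) : (Fin n → Polynomial K) ⧸ Mmod a)) ''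
              {μ | sTopLT s μ (d, j)})} (δ j) := by
  intro j
  let φ : (Fin m → Polynomial K) →ₗ[K] ((Fin n → Polynomial K) ⧸ Mmod a) :=
    ((Mmod a).mkQ ∘ₗ Matrix.vecMulLinear (R := Polynomial K) M).restrictScalars K
  have hker (v : Fin m → Polynomial K) :
      φ v = 0 ↔ v ∈ Submodule.span (Polynomial K) (Set.range P) := by
    rw [hbasis.2, Submodule.mem_comap]
    exact Submodule.Quotient.mk_eq_zero _
  have hset (d : ℕ) : (Submodule.Quotient.mk (pmul M (monov (d, j))) :
        (Fin n → Polynomial K) ⧸ Mmod a) ∈ Submodule.span K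
          ((fun μ : ℕ × Fin m =>
            (Submodule.Quotient.mk (pmul M (monov μ)) : (Fin n → Polynomial K) ⧸ Mmod a)) ''
              {μ | sTopLT s μ (d, j)}) ↔
      ∃ v : Fin m → Polynomial K,
        (∀ i k, (v i).coeff k ≠ 0 → sTopKey s (k, i) < sTopKey s (d, j)) ∧
          φ v = φ (monov (d, j)) := by
    have himage : (fun μ : ℕ × Fin m =>
        (Submodule.Quotient.mk (pmul M (monov μ)) : (Fin n → Polynomial K) ⧸ Mmod a)) ''
          {μ | sTopLT s μ (d, j)} = φ '' (monov '' {μ | sTopLT s μ (d, j)}) := by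
      rw [Set.image_image]; rfl
    rw [himage, Submodule.span_image, Submodule.mem_map]
    simp only [mem_span_monov_iff, Set.mem_ofPred_eq, sTopLT_iff_key]
    rfl
  constructor
  · rw [Set.mem_ofPred_eq, hset]
    have hc : (P j j).coeff (δ j) ≠ 0 := coeff_ne_zero_of_eq_degree (hpiv j).1
    refine ⟨monov (δ j, j) - ((P j j).coeff (δ j))⁻¹ • P j, fun i k hik => ?_, ?_⟩
    · rw [Pi.sub_apply, Pi.smul_apply, coeff_sub, coeff_smul, coeff_monov] at hik
      split_ifs at hik with h
      · obtain ⟨rfl, rfl⟩ := Prod.mk.inj h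
        exact absurd (by simp [hc]) hik
      · refine lt_of_le_of_ne ((hpiv j).key_le fun h0 => hik (by simp [h0])) fun he => ?_
        exact h (sTopKey_injective s he)
    · rw [map_sub, map_smul, (hker (P j)).mpr (Submodule.subset_span ⟨j, rfl⟩), smul_zero, sub_zero]
  · intro d hd
    rw [Set.mem_ofPred_eq, hset] at hd
    obtain ⟨v, hv, hφ⟩ := hd
    have hmem : monov (d, j) - v ∈ Submodule.span (Polynomial K) (Set.range P) := by
      rw [← hker, map_sub, hφ, sub_self]
    obtain ⟨u, hu⟩ := (Submodule.mem_span_range_iff_exists_fun _).mp hmem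
    refine pivot_degree_le_of_combination hpiv u (j := j) (d := d) ?_ ?_
    · rw [hu, Pi.sub_apply, coeff_sub, coeff_monov, if_pos rfl]
      have hv0 : (v j).coeff d = 0 := by
        by_contra h
        exact lt_irrefl _ (hv j d h)
      simp [hv0]
    · intro i k h
      rw [hu, Pi.sub_apply, coeff_sub, coeff_monov] at h
      split_ifs at h with h'
      · rw [h']
      · exact (hv i k fun h0 => h (by simp [h0])).le
end
end
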